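/- arXiv:1710.00125 — 5 statements merged into one kernel-verified Lean document; each statement's English description precedes it below -/
import Mathlib

section
/- Let x ∈ ℝⁿ be a fixed vector, let 0 < ε < 1, and let Ω ∈ ℝ^{p×n} be a random matrix whose entries are independent and identically distributed standard Gaussian random variables (each with law N(0,1)). Then the probability that √(1-ε)·‖x‖₂ ≤ ‖(1/√p)·Ωx‖₂ ≤ √(1+ε)·‖x‖₂ is at least 1 − 2·exp(−(ε² − ε³)·p/4). -/
open MeasureTheory ProbabilityTheory

/-- The law of a `p × n` random matrix with i.i.d. standard Gaussian entries. -/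
noncomputable def gaussianMatrix (p n : ℕ) : Measure (Fin p → Fin n → ℝ) :=
  Measure.pi fun _ : Fin p => Measure.pi fun _ : Fin n => gaussianReal 0 1

/-- Euclidean norm of a vector. -/
noncomputable def norm2 {k : ℕ} (v : Fin k → ℝ) : ℝ := Real.sqrt (∑ i, v i ^ 2)

/-- A unit linear combination of independent standard Gaussians is standard Gaussian. -/
lemma map_sum_mul_pi_gaussianReal {ι : Type*} [Fintype ι] (u : ι → ℝ) (hu : ∑ j, u j ^ 2 = 1) :
    (Measure.pi fun _ : ι => gaussianReal 0 1).map (fun ω => ∑ j, ω j * u j) =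
      gaussianReal 0 1 := by
  refine Measure.ext_of_charFun ?_
  ext t
  have hm : Measurable fun ω : ι → ℝ => ∑ j, ω j * u j := by fun_prop
  rw [charFun_apply_real, integral_map hm.aemeasurable (by fun_prop)]
  have h : ∀ ω : ι → ℝ, Complex.exp (t * ((∑ j, ω j * u j : ℝ) : ℂ) * Complex.I) =
      ∏ j, Complex.exp (((t * u j : ℝ) : ℂ) * ω j * Complex.I) := by
    intro ω
    rw [← Complex.exp_sum]
    congr 1
    push_cast
    rw [Finset.mul_sum, Finset.sum_mul]
    exact Finset.sum_congr rfl fun j _ => by ring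
  simp_rw [h]
  rw [integral_fintype_prod_eq_prod
    (f := fun j (x : ℝ) => Complex.exp (((t * u j : ℝ) : ℂ) * x * Complex.I))]
  simp_rw [← charFun_apply_real, charFun_gaussianReal]
  rw [← Complex.exp_sum]
  congr 1
  have hu' : ∑ j, (u j : ℂ) ^ 2 = 1 := by exact_mod_cast hu
  simp only [Complex.ofReal_mul, Complex.ofReal_zero, mul_zero, zero_mul, zero_sub,
    NNReal.coe_one, Complex.ofReal_one, one_mul, mul_pow]
  rw [Finset.sum_neg_distrib, ← Finset.sum_div, ← Finset.mul_sum, hu', mul_one]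

lemma gaussianPDFReal_mul_exp_mul_sq (t x : ℝ) :
    gaussianPDFReal 0 1 x * Real.exp (t * x ^ 2) =
      (√(2 * Real.pi))⁻¹ * Real.exp (-(1 / 2 - t) * x ^ 2) := by
  simp only [gaussianPDFReal, NNReal.coe_one, mul_one, sub_zero]
  rw [mul_assoc, ← Real.exp_add]
  congr 2
  ring

lemma integrable_exp_mul_sq_gaussianReal {t : ℝ} (ht : t < 1 / 2) :
    Integrable (fun x => Real.exp (t * x ^ 2)) (gaussianReal 0 1) := by
  rw [gaussianReal_of_var_ne_zero _ one_ne_zero, integrable_withDensity_iff_integrable_smul'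
    (measurable_gaussianPDF _ _) (ae_of_all _ fun _ => gaussianPDF_lt_top)]
  simp_rw [toReal_gaussianPDF, smul_eq_mul, gaussianPDFReal_mul_exp_mul_sq]
  exact (integrable_exp_neg_mul_sq (by linarith)).const_mul _

lemma mgf_sq_gaussianReal {t : ℝ} (ht : t < 1 / 2) :
    mgf (fun x => x ^ 2) (gaussianReal 0 1) t = √(1 / (1 - 2 * t)) := by
  rw [mgf, integral_gaussianReal_eq_integral_smul one_ne_zero]
  simp_rw [smul_eq_mul, gaussianPDFReal_mul_exp_mul_sq]
  have hpi := Real.pi_pos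
  have h : 0 < 1 - 2 * t := by linarith
  rw [integral_const_mul, integral_gaussian, ← Real.sqrt_inv, ← Real.sqrt_mul (by positivity)]
  congr 1
  have : 1 / 2 - t ≠ 0 := by linarith
  field_simp

section ChiSquare

variable {α ι : Type*} {mα : MeasurableSpace α} [Fintype ι] {μ : Measure α} {Z : ι → α → ℝ}

lemma integrable_exp_mul_sum_sq (hZ : ∀ i, Measurable (Z i))
    (hlaw : ∀ i, μ.map (Z i) = gaussianReal 0 1) (hind : iIndepFun Z μ) {t : ℝ} (ht : t < 1 / 2) :
    Integrable (fun ω => Real.exp (t * ∑ i, Z i ω ^ 2)) μ := by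
  have : IsProbabilityMeasure μ := hind.isProbabilityMeasure
  have h := (hind.comp (fun _ x => x ^ 2) fun _ => by fun_prop).integrable_exp_mul_sum (t := t)
    (fun i => by have := hZ i; fun_prop) (s := Finset.univ) fun i _ => by
      have h := integrable_exp_mul_sq_gaussianReal ht
      rw [← hlaw i] at h
      exact h.comp_measurable (hZ i)
  simpa using h

lemma mgf_sum_sq (hZ : ∀ i, Measurable (Z i))
    (hlaw : ∀ i, μ.map (Z i) = gaussianReal 0 1) (hind : iIndepFun Z μ) {t : ℝ} (ht : t < 1 / 2) :
    mgf (fun ω => ∑ i, Z i ω ^ 2) μ t = √(1 / (1 - 2 * t)) ^ Fintype.card ι := by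
  have h := (hind.comp (fun _ x => x ^ 2) fun _ => by fun_prop).mgf_sum (t := t)
    (fun i => by have := hZ i; fun_prop) Finset.univ
  have h1 : ∀ i, mgf ((fun x : ℝ => x ^ 2) ∘ Z i) μ t = √(1 / (1 - 2 * t)) := fun i => by
    rw [← mgf_map (hZ i).aemeasurable (by fun_prop), hlaw i, mgf_sq_gaussianReal ht]
  simp_rw [h1, Finset.prod_const, Finset.card_univ] at h
  rw [← h]
  congr 1
  ext ω
  simp

/-- The optimised Chernoff exponent for a chi-square variable at level `1 + δ`. -/
lemma exp_mul_mgf_sum_sq_le (hZ : ∀ i, Measurable (Z i))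
    (hlaw : ∀ i, μ.map (Z i) = gaussianReal 0 1) (hind : iIndepFun Z μ) {δ c : ℝ} (hδ : -1 < δ)
    (hlog : Real.log (1 + δ) ≤ δ - c / 2) :
    Real.exp (-(δ / (2 * (1 + δ))) * ((1 + δ) * Fintype.card ι)) *
        mgf (fun ω => ∑ i, Z i ω ^ 2) μ (δ / (2 * (1 + δ))) ≤
      Real.exp (-(c * Fintype.card ι / 4)) := by
  have hpos : 0 < 1 + δ := by linarith
  have ht : δ / (2 * (1 + δ)) < 1 / 2 := by
    rw [div_lt_div_iff₀ (by positivity) (by norm_num)]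
    linarith
  have hinv : 1 / (1 - 2 * (δ / (2 * (1 + δ)))) = 1 + δ := by
    have : 1 - 2 * (δ / (2 * (1 + δ))) = 1 / (1 + δ) := by
      field_simp
      ring
    rw [this, one_div_one_div]
  have hsqrt : √(1 + δ) = Real.exp (Real.log (1 + δ) / 2) := by
    rw [← Real.log_sqrt hpos.le, Real.exp_log (Real.sqrt_pos.2 hpos)]
  rw [mgf_sum_sq hZ hlaw hind ht, hinv, hsqrt, ← Real.exp_nat_mul, ← Real.exp_add,
    Real.exp_le_exp]
  have hexp : -(δ / (2 * (1 + δ))) * ((1 + δ) * Fintype.card ι) = -(δ / 2 * Fintype.card ι) := by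
    field_simp
  rw [hexp]
  have := mul_le_mul_of_nonneg_left hlog (Nat.cast_nonneg (α := ℝ) (Fintype.card ι))
  linarith

end ChiSquare

lemma log_one_add_le {x : ℝ} (hx : 0 ≤ x) : Real.log (1 + x) ≤ x - (x ^ 2 - x ^ 3) / 2 := by
  have hmono : MonotoneOn (fun y : ℝ => y - (y ^ 2 - y ^ 3) / 2 - Real.log (1 + y))
      (Set.Ici 0) := by
    have hd : ∀ y : ℝ, 0 ≤ y → HasDerivAt
        (fun y : ℝ => y - (y ^ 2 - y ^ 3) / 2 - Real.log (1 + y))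
        (1 - (2 * y - 3 * y ^ 2) / 2 - 1 / (1 + y)) y := by
      intro y hy
      have h1 := ((hasDerivAt_id y).const_add 1).log (by simp; positivity)
      have h2 := ((hasDerivAt_pow 2 y).sub (hasDerivAt_pow 3 y)).div_const 2
      exact (((hasDerivAt_id y).sub h2).sub h1).congr_deriv (by norm_num)
    refine monotoneOn_of_deriv_nonneg (convex_Ici 0)
      (fun y hy => (hd y hy).continuousAt.continuousWithinAt)
      (fun y hy => ?_) fun y hy => ?_
    · rw [interior_Ici] at hy
      exact (hd y (le_of_lt hy)).differentiableAt.differentiableWithinAt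
    · rw [interior_Ici] at hy
      have hy' : 0 < y := hy
      rw [(hd y hy'.le).deriv, sub_nonneg, div_le_iff₀ (by positivity)]
      nlinarith [pow_pos hy' 2, pow_pos hy' 3]
  have := hmono Set.self_mem_Ici hx hx
  simp at this
  linarith

lemma log_one_sub_le {x : ℝ} (hx0 : 0 ≤ x) (hx1 : x < 1) :
    Real.log (1 - x) ≤ -x - x ^ 2 / 2 := by
  have h := sum_le_hasSum (Finset.range 2) (fun i _ => by positivity)
    (Real.hasSum_pow_div_log_of_abs_lt_one (abs_lt.2 ⟨by linarith, hx1⟩))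
  norm_num [Finset.sum_range_succ] at h
  linarith

/-- Two-sided concentration for a chi-square variable. -/
lemma one_sub_le_measure_sum_sq {α ι : Type*} {mα : MeasurableSpace α} [Fintype ι] {μ : Measure α}
    {Z : ι → α → ℝ} (hZ : ∀ i, Measurable (Z i))
    (hlaw : ∀ i, μ.map (Z i) = gaussianReal 0 1) (hind : iIndepFun Z μ)
    {ε : ℝ} (hε0 : 0 < ε) (hε1 : ε < 1) :
    ENNReal.ofReal (1 - 2 * Real.exp (-((ε ^ 2 - ε ^ 3) * Fintype.card ι / 4))) ≤
      μ {ω | (1 - ε) * Fintype.card ι ≤ ∑ i, Z i ω ^ 2 ∧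
        ∑ i, Z i ω ^ 2 ≤ (1 + ε) * Fintype.card ι} := by
  have : IsProbabilityMeasure μ := hind.isProbabilityMeasure
  set N : ℝ := (Fintype.card ι : ℝ)
  set S : α → ℝ := fun ω => ∑ i, Z i ω ^ 2 with hS
  have hSm : Measurable S := by fun_prop
  have key : ∀ δ : ℝ, -1 < δ → δ / (2 * (1 + δ)) < 1 / 2 := fun δ hδ => by
    have : 0 < 1 + δ := by linarith
    rw [div_lt_div_iff₀ (by positivity) (by norm_num)]
    linarith
  have hup : μ.real {ω | (1 + ε) * N ≤ S ω} ≤ Real.exp (-((ε ^ 2 - ε ^ 3) * N / 4)) :=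
    (measure_ge_le_exp_mul_mgf _ (by positivity)
      (integrable_exp_mul_sum_sq hZ hlaw hind (key ε (by linarith)))).trans
      (exp_mul_mgf_sum_sq_le hZ hlaw hind (by linarith) (log_one_add_le hε0.le))
  have hlog : Real.log (1 + -ε) ≤ -ε - (ε ^ 2 - ε ^ 3) / 2 := by
    have := log_one_sub_le hε0.le hε1
    rw [← sub_eq_add_neg]
    nlinarith [pow_pos hε0 3]
  have hlow : μ.real {ω | S ω ≤ (1 + -ε) * N} ≤ Real.exp (-((ε ^ 2 - ε ^ 3) * N / 4)) :=
    (measure_le_le_exp_mul_mgf _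
      (div_nonpos_of_nonpos_of_nonneg (by linarith) (by linarith))
      (integrable_exp_mul_sum_sq hZ hlaw hind (key (-ε) (by linarith)))).trans
      (exp_mul_mgf_sum_sq_le hZ hlaw hind (by linarith) hlog)
  have hmeas : MeasurableSet {ω | (1 - ε) * N ≤ S ω ∧ S ω ≤ (1 + ε) * N} :=
    (measurableSet_le measurable_const hSm).inter (measurableSet_le hSm measurable_const)
  have hcompl : {ω | (1 - ε) * N ≤ S ω ∧ S ω ≤ (1 + ε) * N}ᶜ ⊆
      {ω | (1 + ε) * N ≤ S ω} ∪ {ω | S ω ≤ (1 + -ε) * N} := by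
    intro ω hω
    by_cases h : (1 - ε) * N ≤ S ω
    · exact Or.inl (le_of_lt (not_le.1 fun h' => hω ⟨h, h'⟩))
    · exact Or.inr (by rw [← sub_eq_add_neg]; exact (not_le.1 h).le)
  have h1 := (measureReal_mono hcompl (measure_ne_top μ _)).trans (measureReal_union_le _ _)
  rw [probReal_compl_eq_one_sub hmeas] at h1
  rw [← ofReal_measureReal (measure_ne_top μ _)]
  exact ENNReal.ofReal_le_ofReal (by linarith)

lemma norm2_const_mul {k : ℕ} (c : ℝ) (v : Fin k → ℝ) :
    norm2 (fun i => c * v i) = |c| * norm2 v := by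
  simp only [norm2, mul_pow]
  rw [← Finset.mul_sum, Real.sqrt_mul (sq_nonneg c), Real.sqrt_sq_eq_abs]

/-- Johnson–Lindenstrauss: for a fixed `x ∈ ℝⁿ` and `0 < ε < 1`, with probability at least
`1 - 2 exp(-(ε² - ε³) p / 4)` over a `p × n` i.i.d. standard Gaussian matrix `Ω`, we have
`√(1-ε) ‖x‖₂ ≤ ‖(1/√p) Ω x‖₂ ≤ √(1+ε) ‖x‖₂`. -/
theorem stmt0 (n p : ℕ) (x : Fin n → ℝ) (ε : ℝ) (hε0 : 0 < ε) (hε1 : ε < 1) :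
    ENNReal.ofReal (1 - 2 * Real.exp (-((ε ^ 2 - ε ^ 3) * (p : ℝ) / 4))) ≤
      gaussianMatrix p n
        {Ω | Real.sqrt (1 - ε) * norm2 x ≤
              norm2 (fun i => (1 / Real.sqrt (p : ℝ)) * ∑ j, Ω i j * x j) ∧
            norm2 (fun i => (1 / Real.sqrt (p : ℝ)) * ∑ j, Ω i j * x j) ≤
              Real.sqrt (1 + ε) * norm2 x} := by
  rcases Nat.eq_zero_or_pos p with rfl | hp
  · rw [ENNReal.ofReal_of_nonpos (by norm_num)]
    exact zero_le
  have hp' : (0 : ℝ) < p := Nat.cast_pos.2 hp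
  rcases (Finset.sum_nonneg fun j _ => sq_nonneg (x j) : 0 ≤ ∑ j, x j ^ 2).eq_or_lt with hx | hx
  · have hx0 : ∀ j, x j = 0 := fun j =>
      pow_eq_zero_iff two_ne_zero |>.1
        ((Finset.sum_eq_zero_iff_of_nonneg fun j _ => sq_nonneg (x j)).1 hx.symm j
          (Finset.mem_univ j))
    have hprob : gaussianMatrix p n Set.univ = 1 := by
      simp [gaussianMatrix]
    simp only [hx0, norm2, mul_zero, Finset.sum_const_zero, ne_eq, OfNat.ofNat_ne_zero,
      not_false_eq_true, zero_pow, Real.sqrt_zero, le_refl, and_self, Set.ofPred_true, hprob]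
    exact ENNReal.ofReal_le_one.2 (by linarith [Real.exp_pos (-((ε ^ 2 - ε ^ 3) * (p : ℝ) / 4))])
  have hr : 0 < norm2 x := Real.sqrt_pos.2 hx
  have hr2 : norm2 x ^ 2 = ∑ j, x j ^ 2 := Real.sq_sqrt hx.le
  have hu : ∑ j, (x j / norm2 x) ^ 2 = 1 := by
    simp_rw [div_pow]
    rw [← Finset.sum_div, ← hr2, div_self (by positivity)]
  set Z : Fin p → (Fin p → Fin n → ℝ) → ℝ := fun i Ω => ∑ j, Ω i j * (x j / norm2 x) with hZdef
  have hrow : Measurable fun ω : Fin n → ℝ => ∑ j, ω j * (x j / norm2 x) := by fun_prop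
  have hZ : ∀ i, Measurable (Z i) := fun i => hrow.comp (measurable_pi_apply i)
  have hind : iIndepFun Z (gaussianMatrix p n) :=
    iIndepFun_pi (X := fun (_ : Fin p) (ω : Fin n → ℝ) => ∑ j, ω j * (x j / norm2 x))
      fun _ => hrow.aemeasurable
  have hlaw : ∀ i, (gaussianMatrix p n).map (Z i) = gaussianReal 0 1 := fun i => by
    have h := Measure.map_map (μ := gaussianMatrix p n) hrow (measurable_pi_apply i)
    rw [gaussianMatrix, (measurePreserving_eval _ i).map_eq,
      map_sum_mul_pi_gaussianReal _ hu] at h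
    exact h.symm
  have hmain := one_sub_le_measure_sum_sq hZ hlaw hind hε0 hε1
  rw [Fintype.card_fin] at hmain
  refine hmain.trans (measure_mono ?_)
  rintro Ω ⟨h1, h2⟩
  have hnorm : norm2 (fun i => (1 / Real.sqrt (p : ℝ)) * ∑ j, Ω i j * x j) =
      √((∑ i, Z i Ω ^ 2) / p) * norm2 x := by
    have h : (fun i => (1 / Real.sqrt (p : ℝ)) * ∑ j, Ω i j * x j) =
        fun i => (norm2 x / √p) * Z i Ω := by
      ext i
      simp only [hZdef, ← mul_div_assoc]
      rw [← Finset.sum_div]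
      field_simp
    rw [h, norm2_const_mul, abs_of_nonneg (by positivity), Real.sqrt_div' _ hp'.le,
      show norm2 (fun i => Z i Ω) = √(∑ i, Z i Ω ^ 2) from rfl]
    ring
  change _ ≤ _ ∧ _ ≤ _
  rw [hnorm]
  exact ⟨mul_le_mul_of_nonneg_right (Real.sqrt_le_sqrt ((le_div_iff₀ hp').2 h1)) hr.le,
    mul_le_mul_of_nonneg_right (Real.sqrt_le_sqrt ((div_le_iff₀ hp').2 h2)) hr.le⟩
end

section
/- Let a, b, d, λ, α, μ, x, y be real numbers with λ = |b| > 0, 0 < α < 1, |a| < α·λ, |d| < α·λ, |x| ≤ λ and |y| ≤ μ. Let (l₁, l₂) = (x, y)·M⁻¹ where M = [[a, b], [b, d]] (so l₁ = (x·d − b·y)/(a·d − b²) and l₂ = (a·y − b·x)/(a·d − b²)). Then |l₁| ≤ (1 + μ/λ)/(1 − α²) and |l₂| ≤ (1 + μ/λ)/(1 − α²). -/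
/-- If the diagonal of a symmetric 2×2 matrix is at most `α|b|` in absolute value, its
determinant is at least `(1 - α²)b²` in absolute value. -/
theorem one_sub_sq_mul_sq_le_abs_det {a b d α : ℝ} (ha : |a| ≤ α * |b|) (hd : |d| ≤ α * |b|) :
    (1 - α ^ 2) * |b| ^ 2 ≤ |a * d - b ^ 2| := by
  have had : |a * d| ≤ (α * |b|) * (α * |b|) := by
    rw [abs_mul]
    exact mul_le_mul ha hd (abs_nonneg d) ((abs_nonneg a).trans ha)
  have h := abs_sub_abs_le_abs_sub (b ^ 2) (a * d)
  rw [abs_sub_comm, abs_pow] at h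
  linarith

/-- A quotient bound for a numerator `p * q - r * s` with `|p|, |q|, |r| ≤ L` and `|s| ≤ μ`. -/
theorem abs_mul_sub_mul_div_le {p q r s D L μ c : ℝ} (hL : 0 < L) (hc : 0 < c)
    (hp : |p| ≤ L) (hq : |q| ≤ L) (hr : |r| ≤ L) (hs : |s| ≤ μ) (hD : c * L ^ 2 ≤ |D|) :
    |(p * q - r * s) / D| ≤ (1 + μ / L) / c := by
  have hμ : 0 ≤ μ := (abs_nonneg s).trans hs
  have hnum : |p * q - r * s| ≤ L * L + L * μ := by
    refine (abs_sub _ _).trans ?_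
    rw [abs_mul, abs_mul]
    gcongr
  calc |(p * q - r * s) / D| = |p * q - r * s| / |D| := abs_div _ _
    _ ≤ (L * L + L * μ) / (c * L ^ 2) := by gcongr
    _ = (1 + μ / L) / c := by field_simp

/-- Bound on the multipliers from a 2×2 pivot: if `λ = |b| > 0`, `0 < α < 1`,
`|a| < αλ`, `|d| < αλ`, `|x| ≤ λ`, `|y| ≤ μ`, and
`(l₁, l₂) = (x, y)·M⁻¹` with `M = [[a, b], [b, d]]`, i.e.
`l₁ = (xd - by)/(ad - b²)` and `l₂ = (ay - bx)/(ad - b²)`, then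
`|l₁| ≤ (1 + μ/λ)/(1 - α²)` and `|l₂| ≤ (1 + μ/λ)/(1 - α²)`. -/
theorem stmt10 (a b d lam α μ x y l₁ l₂ : ℝ) (hlam : lam = |b|) (hlam0 : 0 < lam)
    (hα0 : 0 < α) (hα1 : α < 1) (ha : |a| < α * lam) (hd : |d| < α * lam)
    (hx : |x| ≤ lam) (hy : |y| ≤ μ)
    (hl₁ : l₁ = (x * d - b * y) / (a * d - b ^ 2))
    (hl₂ : l₂ = (a * y - b * x) / (a * d - b ^ 2)) :
    |l₁| ≤ (1 + μ / lam) / (1 - α ^ 2) ∧ |l₂| ≤ (1 + μ / lam) / (1 - α ^ 2) := by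
  have hα : 0 < 1 - α ^ 2 := by nlinarith
  have hαlam : α * lam ≤ lam := mul_le_of_le_one_left hlam0.le hα1.le
  have hD : (1 - α ^ 2) * lam ^ 2 ≤ |a * d - b ^ 2| := by
    subst hlam
    exact one_sub_sq_mul_sq_le_abs_det ha.le hd.le
  constructor
  · rw [hl₁]
    exact abs_mul_sub_mul_div_le hlam0 hα hx (hd.le.trans hαlam) hlam.ge hy hD
  · rw [hl₂, ← abs_neg, ← neg_div, neg_sub]
    exact abs_mul_sub_mul_div_le hlam0 hα hlam.ge hx (ha.le.trans hαlam) hy hD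
end

section
/- Let A = (a_{ij}) ∈ ℝ^{n×n} be a nonzero symmetric matrix. Then either there exists an index i with a_{ii} ≠ 0 (a nonsingular 1×1 principal submatrix), or there exist indices i ≠ j such that the 2×2 principal submatrix [[a_{ii}, a_{ij}], [a_{ij}, a_{jj}]] is nonsingular. -/
/-- A nonzero real symmetric matrix has either a nonzero diagonal entry (a nonsingular
1×1 principal submatrix) or a nonsingular 2×2 principal submatrix
`[[a_{ii}, a_{ij}], [a_{ij}, a_{jj}]]` with `i ≠ j`. -/
theorem stmt12 (n : ℕ) (A : Matrix (Fin n) (Fin n) ℝ) (hsym : A.IsSymm) (hA : A ≠ 0) :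
    (∃ i, A i i ≠ 0) ∨
      ∃ i j : Fin n, i ≠ j ∧
        (!![A i i, A i j; A i j, A j j] : Matrix (Fin 2) (Fin 2) ℝ).det ≠ 0 := by
  by_contra! h
  obtain ⟨hdiag, hdet⟩ := h
  refine hA (Matrix.ext fun i j => ?_)
  rcases eq_or_ne i j with rfl | hij
  · exact hdiag i
  · simpa [Matrix.det_fin_two_of, hdiag] using hdet i j hij
end

section
/- Let n ≥ 2, K ≥ 1, and let c₁, c₂, …, c_n be positive real numbers such that for all indices 1 ≤ k ≤ m ≤ n, the product ∏_{j=k}^{m} ( c_j / √(n − j + 2) ) ≤ K^{m−k+1} · c_k^{m−k+1}. Then for every 1 ≤ m ≤ n, c_m / c₁ ≤ √(n+2) · ( K·√(n+1) )^{2 + ln(n−1)}. -/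
/-- If the average of `y 0, …, y p` never exceeds `y p + L`, then `y 0` exceeds `y p` by at most
`L (1 + H_p)`, where `H_p` is the `p`-th harmonic number. -/
theorem le_add_mul_one_add_harmonic (y : ℕ → ℝ) (L : ℝ) (N : ℕ)
    (h : ∀ p ≤ N, ∑ i ∈ Finset.range (p + 1), y i ≤ ((p : ℝ) + 1) * (y p + L)) :
    y 0 ≤ y N + L * (1 + (harmonic N : ℝ)) := by
  have key : ∀ p ≤ N,
      y 0 ≤ (∑ i ∈ Finset.range (p + 1), y i) / ((p : ℝ) + 1) + L * (harmonic p : ℝ) := by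
    intro p
    induction p with
    | zero => simp
    | succ p ih =>
      intro hp
      have hy := h (p + 1) hp
      rw [Finset.sum_range_succ] at hy ⊢
      rw [harmonic_succ]
      push_cast at hy ⊢
      set T := ∑ i ∈ Finset.range (p + 1), y i
      refine (ih (by omega)).trans ?_
      have hstep : T / ((p : ℝ) + 1) ≤
          (T + y (p + 1)) / ((p : ℝ) + 1 + 1) + L * ((p : ℝ) + 1)⁻¹ := by
        have hdiff : (T + y (p + 1)) / ((p : ℝ) + 1 + 1) + L * ((p : ℝ) + 1)⁻¹
            - T / ((p : ℝ) + 1) =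
            (((p : ℝ) + 1 + 1) * (y (p + 1) + L) - (T + y (p + 1))) /
              (((p : ℝ) + 1) * ((p : ℝ) + 1 + 1)) := by
          field_simp
          ring
        rw [← sub_nonneg, hdiff]
        exact div_nonneg (sub_nonneg.2 hy) (by positivity)
      linarith
  have hN : (∑ i ∈ Finset.range (N + 1), y i) / ((N : ℝ) + 1) ≤ y N + L := by
    rw [div_le_iff₀' (by positivity)]
    exact h N le_rfl
  linarith [key N le_rfl]

/-- Reversing the order of summation over the last `p + 1` indices up to `m`. -/
theorem sum_Icc_sub_eq_sum_range_succ (x : ℕ → ℝ) {m p : ℕ} (hp : p ≤ m) :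
    ∑ j ∈ Finset.Icc (m - p) m, x j = ∑ i ∈ Finset.range (p + 1), x (m - i) := by
  refine Finset.sum_nbij' (fun j => m - j) (fun i => m - i) ?_ ?_ ?_ ?_ ?_
  · intro j hj
    simp only [Finset.mem_Icc, Finset.mem_range] at hj ⊢
    omega
  · intro i hi
    simp only [Finset.mem_Icc, Finset.mem_range] at hi ⊢
    omega
  · intro j hj
    simp only [Finset.mem_Icc] at hj
    omega
  · intro i hi
    simp only [Finset.mem_range] at hi
    omega
  · intro j hj
    simp only [Finset.mem_Icc] at hj
    rw [Nat.sub_sub_self hj.2]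

/-- Wilkinson-style recursion: if `n ≥ 2`, `K ≥ 1`, and positive reals `c₁, …, c_n` satisfy
`∏_{j=k}^{m} (c_j / √(n - j + 2)) ≤ K^{m-k+1} c_k^{m-k+1}` for all `1 ≤ k ≤ m ≤ n`, then
`c_m / c₁ ≤ √(n+2) (K √(n+1))^{2 + ln(n-1)}` for every `1 ≤ m ≤ n`. -/
theorem stmt13 (n : ℕ) (hn : 2 ≤ n) (K : ℝ) (hK : 1 ≤ K) (c : ℕ → ℝ)
    (hc : ∀ j, 1 ≤ j → j ≤ n → 0 < c j)
    (hrec : ∀ k m, 1 ≤ k → k ≤ m → m ≤ n →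
      ∏ j ∈ Finset.Icc k m, (c j / Real.sqrt ((n : ℝ) - (j : ℝ) + 2)) ≤
        K ^ (m - k + 1) * c k ^ (m - k + 1)) :
    ∀ m, 1 ≤ m → m ≤ n →
      c m / c 1 ≤ Real.sqrt ((n : ℝ) + 2) *
        (K * Real.sqrt ((n : ℝ) + 1)) ^ (2 + Real.log ((n : ℝ) - 1)) := by
  intro m hm hmn
  have hn2 : (2 : ℝ) ≤ n := by exact_mod_cast hn
  have hs1 : 1 ≤ Real.sqrt ((n : ℝ) + 1) := Real.one_le_sqrt.2 (by linarith)
  set B := K * Real.sqrt ((n : ℝ) + 1) with hB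
  have hB1 : 1 ≤ B := one_le_mul_of_one_le_of_one_le hK hs1
  have hBpos : 0 < B := by linarith
  have hsum : ∀ p ≤ m - 1, ∑ i ∈ Finset.range (p + 1), Real.log (c (m - i)) ≤
      ((p : ℝ) + 1) * (Real.log (c (m - p)) + Real.log B) := by
    intro p hp
    have hr := hrec (m - p) m (by omega) (by omega) hmn
    have hcpos : 0 < c (m - p) := hc _ (by omega) (by omega)
    have hlen : m - (m - p) + 1 = p + 1 := by omega
    have hcard : (Finset.Icc (m - p) m).card = p + 1 := by
      rw [Nat.card_Icc]
      omega
    have hprod : ∏ j ∈ Finset.Icc (m - p) m, c j ≤ (c (m - p) * B) ^ (p + 1) := by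
      calc ∏ j ∈ Finset.Icc (m - p) m, c j
          ≤ ∏ j ∈ Finset.Icc (m - p) m,
              (c j / Real.sqrt ((n : ℝ) - (j : ℝ) + 2) * Real.sqrt ((n : ℝ) + 1)) := by
            refine Finset.prod_le_prod (fun j hj => ?_) (fun j hj => ?_) <;>
              rw [Finset.mem_Icc] at hj
            · exact (hc j (by omega) (by omega)).le
            · have hj1 : (1 : ℝ) ≤ j := by exact_mod_cast (by omega : 1 ≤ j)
              have hjn : (j : ℝ) ≤ n := by exact_mod_cast (by omega : j ≤ n)
              rw [div_mul_eq_mul_div, le_div_iff₀ (Real.sqrt_pos.2 (by linarith))]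
              exact mul_le_mul_of_nonneg_left (Real.sqrt_le_sqrt (by linarith))
                (hc j (by omega) (by omega)).le
        _ = (∏ j ∈ Finset.Icc (m - p) m, c j / Real.sqrt ((n : ℝ) - (j : ℝ) + 2)) *
              Real.sqrt ((n : ℝ) + 1) ^ (p + 1) := by
            rw [Finset.prod_mul_distrib, Finset.prod_const, hcard]
        _ ≤ K ^ (p + 1) * c (m - p) ^ (p + 1) * Real.sqrt ((n : ℝ) + 1) ^ (p + 1) := by
            rw [hlen] at hr
            gcongr
        _ = (c (m - p) * B) ^ (p + 1) := by
            rw [hB]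
            ring
    have hpos : ∀ j ∈ Finset.Icc (m - p) m, 0 < c j := by
      intro j hj
      rw [Finset.mem_Icc] at hj
      exact hc j (by omega) (by omega)
    have hlog := Real.log_le_log (Finset.prod_pos hpos) hprod
    rw [Real.log_prod fun j hj => (hpos j hj).ne', Real.log_pow,
      Real.log_mul hcpos.ne' hBpos.ne'] at hlog
    rw [← sum_Icc_sub_eq_sum_range_succ (fun j => Real.log (c j)) (by omega)]
    exact_mod_cast hlog
  have hmain := le_add_mul_one_add_harmonic (fun i => Real.log (c (m - i))) (Real.log B) (m - 1) hsum
  simp only [Nat.sub_zero, Nat.sub_sub_self hm] at hmain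
  have hharm : (harmonic (m - 1) : ℝ) ≤ 1 + Real.log ((n : ℝ) - 1) := by
    have hmono : (harmonic (m - 1) : ℝ) ≤ (harmonic (n - 1) : ℝ) := by
      simp only [harmonic]
      exact_mod_cast Finset.sum_le_sum_of_subset_of_nonneg
        (Finset.range_subset_range.2 (by omega)) (fun i _ _ => by positivity)
    have hlog := harmonic_le_one_add_log (n - 1)
    rw [Nat.cast_sub (by omega), Nat.cast_one] at hlog
    exact hmono.trans hlog
  have hc1 := hc 1 le_rfl (by omega)
  have hcm := hc m hm hmn
  have hbound : c m / c 1 ≤ B ^ (2 + Real.log ((n : ℝ) - 1)) := by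
    rw [← Real.log_le_log_iff (div_pos hcm hc1) (Real.rpow_pos_of_pos hBpos _),
      Real.log_div hcm.ne' hc1.ne', Real.log_rpow hBpos]
    nlinarith [mul_le_mul_of_nonneg_left hharm (Real.log_nonneg hB1)]
  exact hbound.trans (le_mul_of_one_le_left (Real.rpow_nonneg hBpos.le _)
    (Real.one_le_sqrt.2 (by linarith)))
end

section
/- Let A = (a_{ij}) ∈ ℝ^{n×n}, let λ = max_{2 ≤ j ≤ n} |a_{j1}| > 0 and suppose |a_{11}| ≤ λ. Let α > 0, C ≥ 1, and let r be an index with |a_{rr}| ≥ α·λ and ‖A(:,r)‖₂ ≤ C·‖A(:,1)‖₂. Then for every index j, |a_{jr}| / |a_{rr}| ≤ (C·√n)/α. -/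
theorem abs_le_norm2 {k : ℕ} (v : Fin k → ℝ) (j : Fin k) : |v j| ≤ norm2 v :=
  Real.abs_le_sqrt
    (Finset.single_le_sum (f := fun i => v i ^ 2) (fun i _ => sq_nonneg (v i)) (Finset.mem_univ j))

theorem norm2_le_sqrt_mul {k : ℕ} (v : Fin k → ℝ) {b : ℝ} (hb : 0 ≤ b) (h : ∀ i, |v i| ≤ b) :
    norm2 v ≤ Real.sqrt k * b := by
  refine Real.sqrt_le_iff.mpr ⟨by positivity, ?_⟩
  calc ∑ i, v i ^ 2 ≤ ∑ _i : Fin k, b ^ 2 :=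
        Finset.sum_le_sum fun i _ => sq_le_sq.mpr ((h i).trans (le_abs_self b))
    _ = (Real.sqrt k * b) ^ 2 := by
        rw [mul_pow, Real.sq_sqrt (Nat.cast_nonneg k)]
        simp

/-- Multiplier bound for a 1×1 pivot `a_{rr}` chosen by the simplified Bunch-Kaufman
strategy: if `λ` is the largest magnitude of the off-diagonal entries of the first column,
`λ > 0`, `|a_{11}| ≤ λ`, `|a_{rr}| ≥ αλ`, and the column-pivot quality guarantee
`‖A(:,r)‖₂ ≤ C ‖A(:,1)‖₂` holds with `C ≥ 1`, then every multiplier satisfies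
`|a_{jr}| / |a_{rr}| ≤ C √n / α`. -/
theorem stmt14 (n : ℕ) [NeZero n] (A : Matrix (Fin n) (Fin n) ℝ)
    (lam α C : ℝ) (hα : 0 < α) (hC : 1 ≤ C)
    (hlam_ub : ∀ j : Fin n, j ≠ 0 → |A j 0| ≤ lam)
    (hlam_mem : ∃ j : Fin n, j ≠ 0 ∧ |A j 0| = lam)
    (hlam0 : 0 < lam)
    (h11 : |A 0 0| ≤ lam)
    (r : Fin n) (hr : α * lam ≤ |A r r|)
    (hcol : norm2 (fun i => A i r) ≤ C * norm2 (fun i => A i 0)) :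
    ∀ j : Fin n, |A j r| / |A r r| ≤ C * Real.sqrt n / α := by
  intro j
  have hfirst : norm2 (fun i => A i 0) ≤ Real.sqrt n * lam := by
    refine norm2_le_sqrt_mul _ hlam0.le fun i => ?_
    by_cases hi : i = 0
    · simpa [hi] using h11
    · exact hlam_ub i hi
  have hpivot : 0 < |A r r| := (mul_pos hα hlam0).trans_le hr
  rw [div_le_div_iff₀ hpivot hα]
  calc |A j r| * α ≤ C * (Real.sqrt n * lam) * α := by
        gcongr
        calc |A j r| ≤ norm2 (fun i => A i r) := abs_le_norm2 (fun i => A i r) j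
          _ ≤ C * norm2 (fun i => A i 0) := hcol
          _ ≤ C * (Real.sqrt n * lam) := by gcongr
    _ = C * Real.sqrt n * (α * lam) := by ring
    _ ≤ C * Real.sqrt n * |A r r| := by gcongr
end
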